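/- Let A ∈ ℝ^{8×8} be any matrix satisfying: A(i,i) ≠ 0 for i = 1,2,3,4; A(1,5), A(1,8), A(2,5), A(2,7), A(3,5), A(3,6), A(4,6), A(4,7), A(5,1), A(5,2), A(5,3), A(6,3), A(6,4), A(7,2), A(7,4), A(8,1) are all nonzero; the diagonal entries A(5,5), A(6,6), A(7,7), A(8,8) are arbitrary real numbers; and all remaining entries of A are zero. Let C ∈ ℝ^{2×8} be any matrix with C(1,4) ≠ 0, C(2,7) ≠ 0 and all other entries zero. Then the pair (A, C) is observable. -/

import Mathlib

open Matrix

/-- A pair `(A, C)` is observable if the only vector `v` with `C * A^k * v = 0`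
for all natural numbers `k` is `v = 0`. -/
def Observable {N p : ℕ} (A : Matrix (Fin N) (Fin N) ℝ) (C : Matrix (Fin p) (Fin N) ℝ) : Prop :=
  ∀ v : Fin N → ℝ, (∀ k : ℕ, C *ᵥ ((A ^ k) *ᵥ v) = 0) → v = 0

/-- The set of positions where the pattern matrix 𝒜_WDN of the triangular WDN has a ∗,
i.e. where every matrix in its pattern class must be nonzero (0-based indexing). -/
def starPositions : Set (Fin 8 × Fin 8) :=
  {(0,0), (1,1), (2,2), (3,3),
   (0,4), (0,7), (1,4), (1,6), (2,4), (2,5), (3,5), (3,6),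
   (4,0), (4,1), (4,2), (5,2), (5,3), (6,1), (6,3), (7,0)}

/-- The set of positions where 𝒜_WDN has a ?, i.e. where the entries are arbitrary. -/
def questionPositions : Set (Fin 8 × Fin 8) :=
  {(4,4), (5,5), (6,6), (7,7)}

/-- If coordinate `i` vanishes along the orbit of `v` under `A`, and `j` is the only index with
`A i j ≠ 0` whose coordinate is not already known to vanish along the orbit, then coordinate `j`
vanishes along the orbit as well. -/
theorem pow_mulVec_apply_eq_zero_of_forced {n R : Type*} [Fintype n] [DecidableEq n]
    [CommRing R] [IsDomain R] {A : Matrix n n R} {v : n → R} {i j : n}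
    (hi : ∀ k : ℕ, ((A ^ k) *ᵥ v) i = 0) (hij : A i j ≠ 0)
    (hl : ∀ l, l ≠ j → A i l = 0 ∨ ∀ k : ℕ, ((A ^ k) *ᵥ v) l = 0) (k : ℕ) :
    ((A ^ k) *ᵥ v) j = 0 := by
  have h := hi (k + 1)
  rw [pow_succ', ← mulVec_mulVec, mulVec, dotProduct, Finset.sum_eq_single j] at h
  · exact (mul_eq_zero.mp h).resolve_left hij
  · intro l _ hlj
    rcases hl l hlj with h0 | h0
    · rw [h0, zero_mul]
    · rw [h0 k, mul_zero]
  · simp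

theorem wdn_observable
    (A : Matrix (Fin 8) (Fin 8) ℝ) (C : Matrix (Fin 2) (Fin 8) ℝ)
    (hAstar : ∀ i j : Fin 8, (i, j) ∈ starPositions → A i j ≠ 0)
    (hAzero : ∀ i j : Fin 8, (i, j) ∉ starPositions ∪ questionPositions → A i j = 0)
    (hC : ∀ i j, C i j ≠ 0 ↔ (i, j) ∈ ({(0,3), (1,6)} : Set (Fin 2 × Fin 8))) :
    Observable A C := by
  intro v hv
  have output {r : Fin 2} {j : Fin 8} (hrj : C r j ≠ 0)
      (h0 : ∀ l, l ≠ j → C r l = 0) (k : ℕ) : ((A ^ k) *ᵥ v) j = 0 := by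
    have h := congrFun (hv k) r
    rw [mulVec, dotProduct, Finset.sum_eq_single j (fun l _ hl => by rw [h0 l hl, zero_mul])
      (by simp)] at h
    exact (mul_eq_zero.mp h).resolve_left hrj
  have h3 : ∀ k : ℕ, ((A ^ k) *ᵥ v) 3 = 0 :=
    output ((hC 0 3).2 (by simp)) fun l hl => by
      by_contra h
      exact hl (by simpa using (hC 0 l).1 h)
  have h6 : ∀ k : ℕ, ((A ^ k) *ᵥ v) 6 = 0 :=
    output ((hC 1 6).2 (by simp)) fun l hl => by
      by_contra h
      exact hl (by simpa using (hC 1 l).1 h)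
  have force (i j : Fin 8) (hi : ∀ k : ℕ, ((A ^ k) *ᵥ v) i = 0) (hij : (i, j) ∈ starPositions)
      (hl : ∀ l, (i, l) ∈ starPositions ∪ questionPositions →
        l = j ∨ ∀ k : ℕ, ((A ^ k) *ᵥ v) l = 0) : ∀ k : ℕ, ((A ^ k) *ᵥ v) j = 0 :=
    pow_mulVec_apply_eq_zero_of_forced hi (hAstar i j hij) fun l hlj =>
      or_iff_not_imp_left.2 fun h =>
        (hl l (by_contra fun hmem => h (hAzero i l hmem))).resolve_left hlj
  have h5 : ∀ k : ℕ, ((A ^ k) *ᵥ v) 5 = 0 := by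
    refine force 3 5 h3 (by simp [starPositions]) fun l hl => ?_
    simp [starPositions, questionPositions] at hl
    rcases hl with rfl | rfl | rfl <;> first | exact Or.inl rfl | exact Or.inr ‹_›
  have h1 : ∀ k : ℕ, ((A ^ k) *ᵥ v) 1 = 0 := by
    refine force 6 1 h6 (by simp [starPositions]) fun l hl => ?_
    simp [starPositions, questionPositions] at hl
    rcases hl with rfl | rfl | rfl <;> first | exact Or.inl rfl | exact Or.inr ‹_›
  have h4 : ∀ k : ℕ, ((A ^ k) *ᵥ v) 4 = 0 := by
    refine force 1 4 h1 (by simp [starPositions]) fun l hl => ?_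
    simp [starPositions, questionPositions] at hl
    rcases hl with rfl | rfl | rfl <;> first | exact Or.inl rfl | exact Or.inr ‹_›
  have h2 : ∀ k : ℕ, ((A ^ k) *ᵥ v) 2 = 0 := by
    refine force 5 2 h5 (by simp [starPositions]) fun l hl => ?_
    simp [starPositions, questionPositions] at hl
    rcases hl with rfl | rfl | rfl <;> first | exact Or.inl rfl | exact Or.inr ‹_›
  have h0 : ∀ k : ℕ, ((A ^ k) *ᵥ v) 0 = 0 := by
    refine force 4 0 h4 (by simp [starPositions]) fun l hl => ?_
    simp [starPositions, questionPositions] at hl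
    rcases hl with rfl | rfl | rfl | rfl <;> first | exact Or.inl rfl | exact Or.inr ‹_›
  have h7 : ∀ k : ℕ, ((A ^ k) *ᵥ v) 7 = 0 := by
    refine force 0 7 h0 (by simp [starPositions]) fun l hl => ?_
    simp [starPositions, questionPositions] at hl
    rcases hl with rfl | rfl | rfl <;> first | exact Or.inl rfl | exact Or.inr ‹_›
  ext l
  rw [Pi.zero_apply, ← one_mulVec v, ← pow_zero A]
  fin_cases l
  · exact h0 0
  · exact h1 0
  · exact h2 0
  · exact h3 0
  · exact h4 0
  · exact h5 0
  · exact h6 0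
  · exact h7 0
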